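/- arXiv:2009.04028 — 3 statements merged into one kernel-verified Lean document; each statement's English description precedes it below -/
import Mathlib

section
/- The Banach algebra B(L₁[0,1]) of all bounded linear operators on the complex Lebesgue space L₁[0,1] is not amenable; that is, B(L₁[0,1]) admits no bounded approximate diagonal. -/
open scoped TensorProduct ENNReal
open MeasureTheory Filter

noncomputable section

/-- Lebesgue measure on `ℝ` restricted to the unit interval `[0,1]`. -/
def μ01 : Measure ℝ := volume.restrict (Set.Icc 0 1)

/-- The complex Lebesgue space `L₁[0,1]`. -/
abbrev L1C : Type := Lp ℂ 1 μ01

/-- The projective tensor norm of an element of the algebraic tensor product `A ⊗[ℂ] A`;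
the projective tensor product `A ⊗̂ A` is the completion of `A ⊗[ℂ] A` in this norm, and a
net in `A ⊗̂ A` witnessing an approximate diagonal may always be taken in the dense
subspace `A ⊗[ℂ] A`. -/
def projNorm {A : Type*} [NonUnitalNormedRing A] [NormedSpace ℂ A]
    (u : TensorProduct ℂ A A) : ℝ :=
  sInf { r : ℝ | ∃ l : List (A × A), u = (l.map fun p => p.1 ⊗ₜ[ℂ] p.2).sum ∧
      r = (l.map fun p => ‖p.1‖ * ‖p.2‖).sum }

/-- The left `A`-bimodule action on `A ⊗ A`: `a • (x ⊗ y) = (a*x) ⊗ y`. -/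
def diagL {A : Type*} [NonUnitalNormedRing A] [NormedSpace ℂ A]
    [SMulCommClass ℂ A A] [IsScalarTower ℂ A A]
    (a : A) (u : TensorProduct ℂ A A) : TensorProduct ℂ A A :=
  TensorProduct.map (LinearMap.mulLeft ℂ a) LinearMap.id u

/-- The right `A`-bimodule action on `A ⊗ A`: `(x ⊗ y) • a = x ⊗ (y*a)`. -/
def diagR {A : Type*} [NonUnitalNormedRing A] [NormedSpace ℂ A]
    [SMulCommClass ℂ A A] [IsScalarTower ℂ A A]
    (a : A) (u : TensorProduct ℂ A A) : TensorProduct ℂ A A :=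
  TensorProduct.map LinearMap.id (LinearMap.mulRight ℂ a) u

/-- The multiplication map `π : A ⊗ A → A`, `π(x ⊗ y) = x*y`. -/
def tensMul {A : Type*} [NonUnitalNormedRing A] [NormedSpace ℂ A]
    [SMulCommClass ℂ A A] [IsScalarTower ℂ A A] :
    TensorProduct ℂ A A →ₗ[ℂ] A :=
  TensorProduct.lift (LinearMap.mul ℂ A)

/-- `A` has a (not necessarily bounded) approximate diagonal: a net `(d_α)` in `A ⊗̂ A`
with `‖a·d_α − d_α·a‖ → 0` and `‖a π(d_α) − a‖ → 0` for every `a ∈ A`.  This is formulated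
via the equivalent cofinal finite-set/ε criterion (the net is then indexed by pairs
`(S, ε)` ordered by inclusion/refinement). -/
def HasApproxDiagonal (A : Type*) [NonUnitalNormedRing A] [NormedSpace ℂ A]
    [SMulCommClass ℂ A A] [IsScalarTower ℂ A A] : Prop :=
  ∀ (S : Finset A) (ε : ℝ), 0 < ε → ∃ u : TensorProduct ℂ A A,
    ∀ a ∈ S, projNorm (diagL a u - diagR a u) < ε ∧ ‖a * tensMul u - a‖ < ε

/-- `A` is amenable: it has a bounded approximate diagonal. -/
def IsAmenable (A : Type*) [NonUnitalNormedRing A] [NormedSpace ℂ A]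
    [SMulCommClass ℂ A A] [IsScalarTower ℂ A A] : Prop :=
  ∃ C : ℝ, ∀ (S : Finset A) (ε : ℝ), 0 < ε → ∃ u : TensorProduct ℂ A A,
    projNorm u ≤ C ∧
    ∀ a ∈ S, projNorm (diagL a u - diagR a u) < ε ∧ ‖a * tensMul u - a‖ < ε

/-- `A` is approximately amenable: its forced unitization `A# = ℂ ⊕ A` (equipped with the
ℓ¹ norm `‖(λ, a)‖ = ‖λ‖ + ‖a‖`) has a, not necessarily bounded, approximate diagonal. -/
def IsApproxAmenable (A : Type*) [NonUnitalNormedRing A] [NormedSpace ℂ A]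
    [SMulCommClass ℂ A A] [IsScalarTower ℂ A A] : Prop :=
  HasApproxDiagonal (WithLp 1 (Unitization ℂ A))

/-- The ball of radius `R` around the identity in the free group on two generators. -/
abbrev FreeBall (R : ℕ) : Type := {w : FreeGroup Bool // w.norm ≤ R}

instance finite_freeBall (R : ℕ) : Finite (FreeBall R) := by
  have h : {l : List (Bool × Bool) | l.length ≤ R}.Finite := List.finite_length_le _ R
  have := h.to_subtype
  exact Finite.of_injective
    (fun w : FreeBall R => (⟨w.1.toWord, w.2⟩ : {l : List (Bool × Bool) | l.length ≤ R}))
    fun a b hab => Subtype.ext (FreeGroup.toWord_injective (Subtype.ext_iff.1 hab))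

/-- The partial left translation by a generator on a ball of the free group. -/
def freeBallShift (R : ℕ) (b : Bool) :
    {x : FreeBall R // (FreeGroup.of b * x.1).norm ≤ R} ≃
      {x : FreeBall R // ((FreeGroup.of b)⁻¹ * x.1).norm ≤ R} where
  toFun x := ⟨⟨FreeGroup.of b * x.1.1, x.2⟩, by simpa using x.1.2⟩
  invFun x := ⟨⟨(FreeGroup.of b)⁻¹ * x.1.1, x.2⟩, by simpa using x.1.2⟩
  left_inv x := by simp
  right_inv x := by simp

/-- Permutations of a finite ball of the free group that extend the partial left translations. -/
theorem exists_perm_freeBall (R : ℕ) : ∃ p : Bool → Equiv.Perm (FreeBall R),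
    ∀ b (x y : FreeBall R), y.1 = FreeGroup.of b * x.1 → p b x = y := by
  classical
  have := Fintype.ofFinite (FreeBall R)
  refine ⟨fun b => (freeBallShift R b).extendSubtype, fun b x y hxy => ?_⟩
  rw [Equiv.extendSubtype_apply_of_mem _ x (by rw [← hxy]; exact y.2)]
  exact Subtype.ext hxy.symm

/-- The free group on two generators has finite quotients in which no nonempty reduced word of
length at most `R` is trivial. -/
theorem exists_finite_quotient_injective_on_ball (R : ℕ) :
    ∃ φ : FreeGroup Bool →* Equiv.Perm (FreeBall R),
      ∀ L : List (Bool × Bool), FreeGroup.IsReduced L → L.length ≤ R →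
        φ (FreeGroup.mk L) = 1 → L = [] := by
  obtain ⟨p, hp⟩ := exists_perm_freeBall R
  refine ⟨FreeGroup.lift p, fun L hL hlen h1 => ?_⟩
  have key : ∀ L : List (Bool × Bool), ∀ h : L.length ≤ R,
      FreeGroup.lift p (FreeGroup.mk L) ⟨1, by simp⟩
        = ⟨FreeGroup.mk L, FreeGroup.norm_mk_le.trans h⟩ := by
    intro L
    induction L with
    | nil => intro _; rfl
    | cons l L ih =>
      intro h
      have hL : L.length ≤ R := (Nat.le_succ _).trans h
      obtain ⟨b, s⟩ := l
      have hsplit : FreeGroup.mk ((b, s) :: L) = FreeGroup.mk [(b, s)] * FreeGroup.mk L := by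
        simp [FreeGroup.mul_mk]
      have hb : FreeGroup.lift p (FreeGroup.mk ((b, s) :: L))
          = FreeGroup.lift p (FreeGroup.mk [(b, s)]) * FreeGroup.lift p (FreeGroup.mk L) := by
        rw [hsplit, map_mul]
      rw [hb, Equiv.Perm.mul_apply, ih hL]
      cases s with
      | true =>
        rw [show FreeGroup.mk [(b, true)] = FreeGroup.of b from rfl, FreeGroup.lift_apply_of]
        exact hp b _ _ hsplit
      | false =>
        have hinv : FreeGroup.mk [(b, false)] = (FreeGroup.of b)⁻¹ := by
          simp [FreeGroup.of, FreeGroup.inv_mk, FreeGroup.invRev]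
        rw [hinv, map_inv, FreeGroup.lift_apply_of, Equiv.Perm.inv_eq_iff_eq]
        refine (hp b _ _ ?_).symm
        change FreeGroup.mk L = FreeGroup.of b * FreeGroup.mk ((b, false) :: L)
        rw [hsplit, hinv, mul_inv_cancel_left]
  have h2 := key L hlen
  rw [h1] at h2
  have h3 : FreeGroup.mk L = 1 := (Subtype.ext_iff.1 h2).symm
  rw [← hL.reduce_eq, ← FreeGroup.toWord_mk, h3, FreeGroup.toWord_one]

/-- In a quotient of the free group of girth larger than `R`, every nonempty set of at most `R`
points contains a point with at most one neighbour in the set. -/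
theorem exists_leaf {G : Type*} [Group G] {R : ℕ} (φ : FreeGroup Bool →* G)
    (hφ : ∀ L : List (Bool × Bool), FreeGroup.IsReduced L → L.length ≤ R →
        φ (FreeGroup.mk L) = 1 → L = []) (F : Finset G) (hF : F.Nonempty) (hR : F.card ≤ R) :
    ∃ y ∈ F, ∀ l l' : Bool × Bool, φ (FreeGroup.mk [l]) * y ∈ F →
      φ (FreeGroup.mk [l']) * y ∈ F → l = l' := by
  classical
  by_contra! hcon
  have step : ∀ y ∈ F, ∀ l₀ : Bool × Bool, ∃ l, l ≠ l₀ ∧ φ (FreeGroup.mk [l]) * y ∈ F := by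
    intro y hy l₀
    obtain ⟨l, l', h1, h2, hne⟩ := hcon y hy
    by_cases h : l = l₀
    · exact ⟨l', fun h' => hne (h.trans h'.symm), h2⟩
    · exact ⟨l, h, h1⟩
  obtain ⟨x, hx⟩ := hF
  have path : ∀ N : ℕ, ∃ L : List (Bool × Bool), L.length = N ∧ FreeGroup.IsReduced L ∧
      ∀ s, s <:+ L → φ (FreeGroup.mk s) * x ∈ F := by
    intro N
    induction N with
    | zero =>
      refine ⟨[], rfl, FreeGroup.IsReduced.nil, fun s hs => ?_⟩
      rw [List.suffix_nil.1 hs, ← FreeGroup.one_eq_mk]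
      simpa using hx
    | succ N ih =>
      obtain ⟨L, hlen, hred, hsuf⟩ := ih
      have hcons : ∀ l, φ (FreeGroup.mk [l]) * (φ (FreeGroup.mk L) * x) ∈ F →
          FreeGroup.IsReduced (l :: L) → ∃ L : List (Bool × Bool), L.length = N + 1 ∧
            FreeGroup.IsReduced L ∧ ∀ s, s <:+ L → φ (FreeGroup.mk s) * x ∈ F := by
        intro l hl hr
        refine ⟨l :: L, by simp [hlen], hr, fun s hs => ?_⟩
        rcases List.suffix_cons_iff.1 hs with rfl | hs
        · have : FreeGroup.mk (l :: L) = FreeGroup.mk [l] * FreeGroup.mk L := by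
            simp [FreeGroup.mul_mk]
          rw [this, map_mul, mul_assoc]
          exact hl
        · exact hsuf s hs
      have hmem := hsuf L List.suffix_rfl
      cases L with
      | nil =>
        obtain ⟨l, -, hl⟩ := step _ hmem (true, true)
        exact hcons l hl FreeGroup.IsReduced.singleton
      | cons a L' =>
        obtain ⟨l, hne, hl⟩ := step _ hmem (a.1, !a.2)
        refine hcons l hl (FreeGroup.isReduced_cons_cons.2 ⟨fun h1 => ?_, hred⟩)
        by_contra h2
        exact hne (Prod.ext h1 (Bool.eq_not_iff.2 h2))
  obtain ⟨L, hlen, hred, hsuf⟩ := path F.card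
  have hmaps : ∀ k ∈ Finset.range (F.card + 1), φ (FreeGroup.mk (L.drop k)) * x ∈ F :=
    fun k _ => hsuf _ (List.drop_suffix k L)
  obtain ⟨i, hi, j, hj, hij, heq⟩ := Finset.exists_ne_map_eq_of_card_lt_of_maps_to
    (by simp) hmaps
  wlog hlt : i < j generalizing i j
  · exact this j hj i hi hij.symm heq.symm (by omega)
  have hj' : j ≤ L.length := by simpa [hlen, Nat.lt_succ_iff] using hj
  have hsplit : L.drop i = (L.drop i).take (j - i) ++ L.drop j := by
    conv_lhs => rw [← List.take_append_drop (j - i) (L.drop i)]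
    rw [List.drop_drop]
    congr 2
    omega
  have hnil : (L.drop i).take (j - i) = [] := by
    refine hφ _ ?_ ?_ ?_
    · have h : FreeGroup.IsReduced (L.take i ++ L.drop i) := by rwa [List.take_append_drop]
      have h' := List.IsChain.right_of_append h
      rw [← List.take_append_drop (j - i) (L.drop i)] at h'
      exact List.IsChain.left_of_append h'
    · simp only [List.length_take, List.length_drop]; omega
    · have h := mul_right_cancel heq
      rw [hsplit, ← FreeGroup.mul_mk, map_mul] at h
      simpa using h
  have := congrArg List.length hnil
  simp only [List.length_take, List.length_drop, List.length_nil] at this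
  omega

/-- Small subsets of a large-girth quotient of the free group span few edges. -/
theorem sum_card_edges_le {G : Type*} [Group G] [DecidableEq G] {R : ℕ} (φ : FreeGroup Bool →* G)
    (hφ : ∀ L : List (Bool × Bool), FreeGroup.IsReduced L → L.length ≤ R →
        φ (FreeGroup.mk L) = 1 → L = []) (F : Finset G) (hR : F.card ≤ R) :
    ∑ b : Bool, (F.filter fun x => φ (FreeGroup.of b) * x ∈ F).card ≤ F.card := by
  induction h : F.card generalizing F with
  | zero => simp [Finset.card_eq_zero.1 h]
  | succ N ih =>
    obtain ⟨y, hy, hleaf⟩ := exists_leaf φ hφ F (Finset.card_pos.1 (by omega)) hR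
    have hcard : (F.erase y).card = N := by rw [Finset.card_erase_of_mem hy]; omega
    have h1 := ih (F.erase y) (by omega) hcard
    have h2 : ∀ b : Bool, (F.filter fun x => φ (FreeGroup.of b) * x ∈ F).card ≤
        ((F.erase y).filter fun x => φ (FreeGroup.of b) * x ∈ F.erase y).card +
          ∑ s : Bool, if φ (FreeGroup.mk [(b, s)]) * y ∈ F then 1 else 0 := by
      intro b
      have hinv : φ (FreeGroup.mk [(b, false)]) = (φ (FreeGroup.of b))⁻¹ := by
        rw [← map_inv]; simp [FreeGroup.of, FreeGroup.inv_mk, FreeGroup.invRev]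
      have hsub : (F.filter fun x => φ (FreeGroup.of b) * x ∈ F) ⊆
          ((F.erase y).filter fun x => φ (FreeGroup.of b) * x ∈ F.erase y) ∪
            ((if φ (FreeGroup.mk [(b, true)]) * y ∈ F then {y} else ∅) ∪
            (if φ (FreeGroup.mk [(b, false)]) * y ∈ F then
              {φ (FreeGroup.mk [(b, false)]) * y} else ∅)) := by
        intro x hx
        rw [Finset.mem_filter] at hx
        by_cases hxy : x = y
        · subst hxy
          have : φ (FreeGroup.mk [(b, true)]) * x ∈ F := hx.2
          simp [this]
        by_cases hxy' : φ (FreeGroup.of b) * x = y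
        · have hx' : φ (FreeGroup.mk [(b, false)]) * y = x := by rw [hinv, ← hxy']; group
          simp [hx', hx.1]
        · simp [hx, hxy, hxy']
      refine (Finset.card_le_card hsub).trans ((Finset.card_union_le _ _).trans ?_)
      gcongr
      refine (Finset.card_union_le _ _).trans ?_
      rw [Fintype.sum_bool]
      gcongr <;> split_ifs <;> simp
    have h3 : ∑ b : Bool, ∑ s : Bool,
        (if φ (FreeGroup.mk [(b, s)]) * y ∈ F then 1 else 0) ≤ 1 := by
      rw [← Fintype.sum_prod_type', Finset.sum_boole, Nat.cast_id, Finset.card_le_one]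
      intro l hl l' hl'
      exact hleaf l l' (by simpa using hl) (by simpa using hl')
    calc _ ≤ _ := Finset.sum_le_sum fun b _ => h2 b
      _ ≤ N + 1 := by rw [Finset.sum_add_distrib]; omega

/-- Pairs of permutations of finite sets for which all subsets of cardinality at most `R` span at
most as many edges as they have points. -/
theorem exists_perm_small_sets_sparse (R : ℕ) : ∃ (n : ℕ) (σ : Bool → Equiv.Perm (Fin n)),
    0 < n ∧ ∀ F : Finset (Fin n), F.card ≤ R →
      ∑ b : Bool, (F.filter fun x => σ b x ∈ F).card ≤ F.card := by
  classical
  obtain ⟨φ, hφ⟩ := exists_finite_quotient_injective_on_ball R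
  have := Fintype.ofFinite (FreeBall R)
  let e := Fintype.equivFin (Equiv.Perm (FreeBall R))
  refine ⟨Fintype.card (Equiv.Perm (FreeBall R)),
    fun b => e.permCongr (Equiv.mulLeft (φ (FreeGroup.of b))), Fintype.card_pos, fun F hF => ?_⟩
  have h := sum_card_edges_le φ hφ (F.map e.symm.toEmbedding) (by simpa using hF)
  rw [Finset.card_map] at h
  refine le_trans (Finset.sum_le_sum fun b _ => ?_) h
  refine Finset.card_le_card_of_injOn e.symm (fun x hx => ?_) e.symm.injective.injOn
  have hx := Finset.mem_filter.1 (Finset.mem_coe.1 hx)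
  refine Finset.mem_coe.2 (Finset.mem_filter.2
    ⟨Finset.mem_map_of_mem e.symm.toEmbedding hx.1, ?_⟩)
  have := Finset.mem_map_of_mem e.symm.toEmbedding hx.2
  simpa [Equiv.permCongr_apply] using this

/-- A relation with few pairs on a large finite set admits an independent set of prescribed size. -/
theorem exists_independent_of_few_pairs {V : Type*} [Fintype V] (P : V → V → Prop)
    [DecidablePred fun x : V × V => x.1 ≠ x.2 ∧ P x.1 x.2] (r K : ℕ)
    (hcount : (Finset.univ.filter fun x : V × V => x.1 ≠ x.2 ∧ P x.1 x.2).card ≤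
      K * Fintype.card V)
    (hbig : r * (1 + 2 * K) < Fintype.card V) :
    ∃ I : Finset V, I.card = r + 1 ∧ ∀ i ∈ I, ∀ j ∈ I, i ≠ j → ¬ P i j := by
  classical
  let H : SimpleGraph V :=
    { Adj := fun i j => i ≠ j ∧ ¬ P i j ∧ ¬ P j i
      symm := ⟨fun i j h => ⟨h.1.symm, h.2.2, h.2.1⟩⟩
      loopless := ⟨fun i h => h.1 rfl⟩ }
  suffices hH : ¬ H.CliqueFree (r + 1) by
    simp only [SimpleGraph.CliqueFree, not_forall, not_not] at hH
    obtain ⟨I, hI⟩ := hH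
    exact ⟨I, hI.card_eq, fun i hi j hj hij => (hI.isClique hi hj hij).2.1⟩
  intro hfree
  rcases r.eq_zero_or_pos with rfl | hr
  · rw [zero_add, SimpleGraph.cliqueFree_one, ← Fintype.card_eq_zero_iff] at hfree
    omega
  obtain ⟨M, _, hM⟩ := SimpleGraph.exists_isTuranMaximal (V := V) hr
  have h1 : H.edgeFinset.card ≤ M.edgeFinset.card := hM.2 hfree
  rw [((SimpleGraph.isTuranMaximal_iff_nonempty_iso_turanGraph hr).mp hM).some.card_edgeFinset_eq]
    at h1
  have h2 := SimpleGraph.mul_card_edgeFinset_turanGraph_le (n := Fintype.card V) (r := r)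
  have h3 := H.two_mul_card_edgeFinset
  set bad := Finset.univ.filter fun x : V × V => x.1 ≠ x.2 ∧ P x.1 x.2 with hbad
  have h4 : (Finset.univ : Finset (V × V)) ⊆ (Finset.univ.filter fun (x, y) ↦ H.Adj x y) ∪
      (Finset.univ.diag ∪ (bad ∪ bad.map (Equiv.prodComm V V).toEmbedding)) := by
    rintro ⟨i, j⟩ -
    by_cases hij : i = j
    · simp [hij]
    by_cases hP : P i j
    · simp [hbad, hij, hP]
    by_cases hP' : P j i
    · simp [hbad, Ne.symm hij, hP']
    · simp [H, hij, hP, hP']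
  have h5 := (Finset.card_le_card h4).trans ((Finset.card_union_le _ _).trans
    (Nat.add_le_add_left ((Finset.card_union_le _ _).trans
      (Nat.add_le_add_left (Finset.card_union_le _ _) _)) _))
  rw [Finset.card_univ, Fintype.card_prod, ← h3, Finset.diag_card, Finset.card_univ,
    Finset.card_map] at h5
  obtain ⟨q, rfl⟩ : ∃ q, r = q + 1 := ⟨r - 1, by omega⟩
  rw [Nat.add_sub_cancel] at h2
  generalize Fintype.card V = N at *
  have h6 : 2 * (q + 1) * H.edgeFinset.card ≤ q * N ^ 2 := le_trans (by gcongr) h2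
  nlinarith

/-- A matrix of rank at most `r` with many diagonal entries exceeding `s` has many entries
exceeding `s / (r + 1)`. -/
theorem card_large_entries {V : Type*} [Fintype V] {r : ℕ} (A : V → Fin r → ℂ)
    (B : Fin r → V → ℂ) (K : ℕ) {s : ℝ} (hs : 0 < s)
    (hbig : r * (1 + 2 * K) < (Finset.univ.filter fun i => s < ‖∑ k, A i k * B k i‖).card) :
    K * (Finset.univ.filter fun i => s < ‖∑ k, A i k * B k i‖).card ≤
      (Finset.univ.filter fun x : V × V =>
        s < (r + 1) * ‖∑ k, A x.1 k * B k x.2‖).card := by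
  classical
  by_contra! hlt
  set L := Finset.univ.filter fun i => s < ‖∑ k, A i k * B k i‖ with hL
  obtain ⟨I, hIcard, hI⟩ := exists_independent_of_few_pairs
    (fun i j : L => s < (r + 1) * ‖∑ k, A i k * B k j‖) r K (by
      rw [Fintype.card_coe]
      refine le_trans (Finset.card_le_card_of_injOn (fun x => (x.1.1, x.2.1)) ?_ ?_) hlt.le
      · intro x hx
        simpa using (Finset.mem_filter.1 (Finset.mem_coe.1 hx)).2.2
      · intro x _ y _ hxy
        simp only [Prod.mk.injEq] at hxy
        exact Prod.ext (Subtype.ext hxy.1) (Subtype.ext hxy.2)) (by rwa [Fintype.card_coe])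
  let A' : Matrix I (Fin r) ℂ := fun i k => A i.1 k
  let B' : Matrix (Fin r) I ℂ := fun k j => B k j.1
  have hAB : ∀ i j, (A' * B') i j = ∑ k, A i.1 k * B k j.1 := fun i j => rfl
  have hdet : (A' * B').det ≠ 0 := by
    refine det_ne_zero_of_sum_row_lt_diag fun k => ?_
    have hk : s < ‖(A' * B') k k‖ := (Finset.mem_filter.1 k.1.2).2
    refine lt_of_le_of_lt ?_ hk
    have hle : ∀ j ∈ Finset.univ.erase k, ‖(A' * B') k j‖ ≤ s / (r + 1) := by
      intro j hj
      have hne : k.1 ≠ j.1 := fun h => Finset.ne_of_mem_erase hj (Subtype.ext h.symm)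
      have := hI k.1 k.2 j.1 j.2 hne
      rw [not_lt] at this
      rw [le_div_iff₀ (by positivity), mul_comm]
      exact this
    refine (Finset.sum_le_card_nsmul _ _ _ hle).trans ?_
    rw [Finset.card_erase_of_mem (Finset.mem_univ _), Finset.card_univ, Fintype.card_coe, hIcard,
      Nat.add_sub_cancel, nsmul_eq_mul, mul_div_assoc', div_le_iff₀ (by positivity)]
    nlinarith
  have h1 := Matrix.rank_of_isUnit (A' * B')
    ((Matrix.isUnit_iff_isUnit_det _).2 (isUnit_iff_ne_zero.2 hdet))
  have h2 := (Matrix.rank_mul_le_left A' B').trans A'.rank_le_card_width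
  rw [h1, Fintype.card_coe, hIcard, Fintype.card_fin] at h2
  omega

/-- The indicator of the superlevel condition `s < a`. -/
def levelInd (a s : ℝ) : ℝ := (Set.Iio a).indicator 1 s

theorem levelInd_eq (a s : ℝ) : levelInd a s = if s < a then 1 else 0 := by
  simp [levelInd, Set.indicator_apply]

theorem integrableOn_levelInd (a : ℝ) : IntegrableOn (levelInd a) (Set.Ioi 0) := by
  unfold IntegrableOn levelInd
  rw [integrable_indicator_iff measurableSet_Iio, IntegrableOn,
    Measure.restrict_restrict measurableSet_Iio, Set.Iio_inter_Ioi]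
  exact integrableOn_const (by simp)

theorem integral_levelInd {a : ℝ} (ha : 0 ≤ a) : ∫ s in Set.Ioi 0, levelInd a s = a := by
  unfold levelInd
  rw [integral_indicator measurableSet_Iio, Measure.restrict_restrict measurableSet_Iio,
    Set.Iio_inter_Ioi]
  simp [ha]

theorem integrableOn_levelInd_sub (a b : ℝ) :
    IntegrableOn (fun s => levelInd a s - levelInd b s) (Set.Ioi 0) :=
  (integrableOn_levelInd a).sub (integrableOn_levelInd b)

/-- If small sets are sparse for `σ`, then the diagonal of a matrix of rank at most `r` is
controlled by its variation along `σ` and by a small multiple of the sum of all entries. -/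
theorem sum_diag_le {n r K : ℕ} (hK : 0 < K) (σ : Bool → Equiv.Perm (Fin n))
    (hσ : ∀ F : Finset (Fin n), F.card ≤ r * (1 + 2 * K) →
      ∑ b : Bool, (F.filter fun x => σ b x ∈ F).card ≤ F.card)
    (A : Fin n → Fin r → ℂ) (B : Fin r → Fin n → ℂ) :
    ∑ i, ‖∑ k, A i k * B k i‖ ≤
      ∑ b : Bool, ∑ i, ‖∑ k, A i k * B k i - ∑ k, A (σ b i) k * B k (σ b i)‖ +
      (r + 1) / K * ∑ i, ∑ j, ‖∑ k, A i k * B k j‖ := by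
  set T : Fin n → Fin n → ℂ := fun i j => ∑ k, A i k * B k j with hT
  change ∑ i, ‖T i i‖ ≤ ∑ b : Bool, ∑ i, ‖T i i - T (σ b i) (σ b i)‖ +
    (r + 1) / K * ∑ i, ∑ j, ‖T i j‖
  have hpt : ∀ s ∈ Set.Ioi (0 : ℝ), ∑ i, levelInd ‖T i i‖ s ≤
      ∑ b : Bool, ∑ i, (levelInd (max ‖T i i‖ ‖T (σ b i) (σ b i)‖) s -
        levelInd (min ‖T i i‖ ‖T (σ b i) (σ b i)‖) s) +
      (K : ℝ)⁻¹ * ∑ i, ∑ j, levelInd ((r + 1) * ‖T i j‖) s := by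
    intro s hs
    set L := Finset.univ.filter fun i => s < ‖T i i‖ with hL
    have h0 : ∑ i, levelInd ‖T i i‖ s = L.card := by
      simp [levelInd_eq, hL, Finset.sum_boole]
    have hpos : ∀ b : Bool, ∀ i, 0 ≤ levelInd (max ‖T i i‖ ‖T (σ b i) (σ b i)‖) s -
        levelInd (min ‖T i i‖ ‖T (σ b i) (σ b i)‖) s := by
      intro b i
      simp only [levelInd_eq, lt_max_iff, lt_min_iff]
      split_ifs with h1 h2 <;> first | (norm_num; done) | (exfalso; tauto)
    have hpos' : 0 ≤ ∑ i, ∑ j, levelInd ((r + 1) * ‖T i j‖) s :=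
      Finset.sum_nonneg fun i _ => Finset.sum_nonneg fun j _ => by
        rw [levelInd_eq]; split_ifs <;> norm_num
    rw [h0]
    rcases le_or_gt L.card (r * (1 + 2 * K)) with hle | hgt
    · have h1 : ∀ b : Bool, (L.card : ℝ) - (L.filter fun x => σ b x ∈ L).card ≤
          ∑ i, (levelInd (max ‖T i i‖ ‖T (σ b i) (σ b i)‖) s -
            levelInd (min ‖T i i‖ ‖T (σ b i) (σ b i)‖) s) := by
        intro b
        have h2 : ((L.filter fun x => σ b x ∈ L).card : ℝ) =
            ∑ i, levelInd (min ‖T i i‖ ‖T (σ b i) (σ b i)‖) s := by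
          simp [levelInd_eq, hL, Finset.sum_boole, Finset.filter_filter]
        rw [h2, ← h0, ← Finset.sum_sub_distrib]
        refine Finset.sum_le_sum fun i _ => sub_le_sub_right ?_ _
        simp only [levelInd_eq, lt_max_iff]
        split_ifs with h1 h2 <;> first | (norm_num; done) | (exfalso; tauto)
      have h3 : ((∑ b : Bool, (L.filter fun x => σ b x ∈ L).card : ℕ) : ℝ) ≤ L.card :=
        Nat.cast_le.2 (hσ L hle)
      have h4 := Finset.sum_le_sum fun b (_ : b ∈ Finset.univ) => h1 b
      rw [Finset.sum_sub_distrib] at h4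
      simp only [Finset.sum_const, Finset.card_univ, Fintype.card_bool, nsmul_eq_mul] at h4
      push_cast at h3 h4
      have h5 : 0 ≤ (K : ℝ)⁻¹ * ∑ i, ∑ j, levelInd ((r + 1) * ‖T i j‖) s := by positivity
      linarith
    · have h1 : ((K * L.card : ℕ) : ℝ) ≤ _ :=
        Nat.cast_le.2 (card_large_entries A B K (Set.mem_Ioi.1 hs) hgt)
      have h2 : ∑ i, ∑ j, levelInd ((r + 1) * ‖T i j‖) s =
          ((Finset.univ.filter fun x : Fin n × Fin n => s < (r + 1) * ‖T x.1 x.2‖).card : ℝ) := by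
        rw [← Fintype.sum_prod_type']
        simp [levelInd_eq, Finset.sum_boole]
      rw [h2]
      have h3 : 0 ≤ ∑ b : Bool, ∑ i, (levelInd (max ‖T i i‖ ‖T (σ b i) (σ b i)‖) s -
          levelInd (min ‖T i i‖ ‖T (σ b i) (σ b i)‖) s) :=
        Finset.sum_nonneg fun b _ => Finset.sum_nonneg fun i _ => hpos b i
      have hK' : (0 : ℝ) < K := Nat.cast_pos.2 hK
      have h4 : (L.card : ℝ) ≤ (K : ℝ)⁻¹ *
          ((Finset.univ.filter fun x : Fin n × Fin n => s < (r + 1) * ‖T x.1 x.2‖).card : ℝ) := by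
        rw [inv_mul_eq_div, le_div_iff₀ hK', mul_comm]
        push_cast at h1
        exact h1
      linarith
  have hi1 : Integrable (fun s => ∑ i, levelInd ‖T i i‖ s) (volume.restrict (Set.Ioi 0)) :=
    integrable_finsetSum _ fun i _ => integrableOn_levelInd _
  have hi2 : Integrable (fun s => ∑ b : Bool, ∑ i,
      (levelInd (max ‖T i i‖ ‖T (σ b i) (σ b i)‖) s -
        levelInd (min ‖T i i‖ ‖T (σ b i) (σ b i)‖) s)) (volume.restrict (Set.Ioi 0)) :=
    integrable_finsetSum _ fun b _ => integrable_finsetSum _ fun i _ =>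
      integrableOn_levelInd_sub _ _
  have hi3 : Integrable (fun s => (K : ℝ)⁻¹ * ∑ i, ∑ j, levelInd ((r + 1) * ‖T i j‖) s)
      (volume.restrict (Set.Ioi 0)) :=
    (integrable_finsetSum _ fun i _ => integrable_finsetSum _ fun j _ =>
      integrableOn_levelInd _).const_mul _
  have hint := setIntegral_mono_on hi1 (hi2.add hi3) measurableSet_Ioi hpt
  have e1 : ∫ s in Set.Ioi 0, ∑ i, levelInd ‖T i i‖ s = ∑ i, ‖T i i‖ := by
    rw [integral_finsetSum _ fun i _ => integrableOn_levelInd _]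
    exact Finset.sum_congr rfl fun i _ => integral_levelInd (norm_nonneg _)
  have e2 : ∫ s in Set.Ioi 0, ∑ b : Bool, ∑ i,
      (levelInd (max ‖T i i‖ ‖T (σ b i) (σ b i)‖) s -
        levelInd (min ‖T i i‖ ‖T (σ b i) (σ b i)‖) s) =
      ∑ b : Bool, ∑ i, |‖T i i‖ - ‖T (σ b i) (σ b i)‖| := by
    rw [integral_finsetSum _ fun b _ => integrable_finsetSum _ fun i _ =>
      integrableOn_levelInd_sub _ _]
    refine Finset.sum_congr rfl fun b _ => ?_
    rw [integral_finsetSum _ fun i _ => integrableOn_levelInd_sub _ _]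
    refine Finset.sum_congr rfl fun i _ => ?_
    rw [integral_sub (integrableOn_levelInd _) (integrableOn_levelInd _),
      integral_levelInd (by positivity), integral_levelInd (by positivity),
      max_sub_min_eq_abs']
  have e3 : ∫ s in Set.Ioi 0, (K : ℝ)⁻¹ * ∑ i, ∑ j, levelInd ((r + 1) * ‖T i j‖) s =
      (r + 1) / K * ∑ i, ∑ j, ‖T i j‖ := by
    rw [integral_const_mul, integral_finsetSum _ fun i _ => integrable_finsetSum _ fun j _ =>
      integrableOn_levelInd _, div_eq_inv_mul, mul_assoc]
    congr 1
    rw [Finset.mul_sum]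
    refine Finset.sum_congr rfl fun i _ => ?_
    rw [integral_finsetSum _ fun j _ => integrableOn_levelInd _, Finset.mul_sum]
    exact Finset.sum_congr rfl fun j _ => integral_levelInd (by positivity)
  rw [e1, integral_add' hi2 hi3, e2, e3] at hint
  refine hint.trans ?_
  gcongr with b _ i _
  exact abs_norm_sub_norm_le _ _

section Tensor

variable {A : Type*} [NonUnitalNormedRing A] [NormedSpace ℂ A]

/-- The functional `x ⊗ y ↦ α x * β y`. -/
def tensFunctional (α β : A →ₗ[ℂ] ℂ) : TensorProduct ℂ A A →ₗ[ℂ] ℂ :=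
  LinearMap.mul' ℂ ℂ ∘ₗ TensorProduct.map α β

@[simp]
theorem tensFunctional_tmul (α β : A →ₗ[ℂ] ℂ) (x y : A) :
    tensFunctional α β (x ⊗ₜ[ℂ] y) = α x * β y := by
  simp [tensFunctional]

theorem exists_eq_sum_fin_tmul (u : TensorProduct ℂ A A) :
    ∃ (r : ℕ) (a b : Fin r → A), u = ∑ k, a k ⊗ₜ[ℂ] b k := by
  induction u using TensorProduct.induction_on with
  | zero => exact ⟨0, fun _ => 0, fun _ => 0, by simp⟩
  | tmul x y => exact ⟨1, fun _ => x, fun _ => y, by simp⟩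
  | add u v hu hv =>
    obtain ⟨r, a, b, rfl⟩ := hu
    obtain ⟨s, c, d, rfl⟩ := hv
    exact ⟨r + s, Fin.append a c, Fin.append b d, by simp [Fin.sum_univ_add]⟩

/-- A family of product functionals that is jointly bounded on elementary tensors is bounded for
the projective norm. -/
theorem sum_norm_tensFunctional_le {ι κ : Type*} [Fintype ι] [Fintype κ] (α β : κ → ι → A →ₗ[ℂ] ℂ)
    {N : ℝ} (hN : 0 < N)
    (h : ∀ x y : A, ∑ m, ∑ i, ∑ j, ‖α m i x‖ * ‖β m j y‖ ≤ N * (‖x‖ * ‖y‖))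
    (u : TensorProduct ℂ A A) :
    ∑ m, ∑ i, ∑ j, ‖tensFunctional (α m i) (β m j) u‖ ≤ N * projNorm u := by
  rw [← div_le_iff₀' hN]
  refine le_csInf ?_ ?_
  · obtain ⟨r, a, b, hu⟩ := exists_eq_sum_fin_tmul u
    exact ⟨_, List.ofFn fun k => (a k, b k), by simpa [List.map_ofFn, List.sum_ofFn] using hu, rfl⟩
  · rintro _ ⟨l, rfl, rfl⟩
    rw [div_le_iff₀' hN]
    induction l with
    | nil => simp
    | cons p l ih =>
      simp only [List.map_cons, List.sum_cons, map_add, tensFunctional_tmul, mul_add]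
      refine le_trans ?_ (add_le_add (h p.1 p.2) ih)
      simp only [← Finset.sum_add_distrib]
      gcongr with m _ i _ j _
      exact (norm_add_le _ _).trans_eq (by rw [norm_mul])

variable [SMulCommClass ℂ A A] [IsScalarTower ℂ A A]

theorem tensFunctional_diagL {a : A} {α α' : A →ₗ[ℂ] ℂ} (β : A →ₗ[ℂ] ℂ)
    (h : ∀ x, α (a * x) = α' x) (u : TensorProduct ℂ A A) :
    tensFunctional α β (diagL a u) = tensFunctional α' β u := by
  induction u using TensorProduct.induction_on with
  | zero => simp [diagL]
  | tmul x y => simp [diagL, h]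
  | add u v hu hv => simp only [diagL, map_add] at hu hv ⊢; rw [hu, hv]

theorem tensFunctional_diagR {a : A} (α : A →ₗ[ℂ] ℂ) {β β' : A →ₗ[ℂ] ℂ}
    (h : ∀ y, β (y * a) = β' y) (u : TensorProduct ℂ A A) :
    tensFunctional α β (diagR a u) = tensFunctional α β' u := by
  induction u using TensorProduct.induction_on with
  | zero => simp [diagR]
  | tmul x y => simp [diagR, h]
  | add u v hu hv => simp only [diagR, map_add] at hu hv ⊢; rw [hu, hv]

end Tensor

section Shift

variable {E ι : Type*} [NormedAddCommGroup E] [NormedSpace ℂ E]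

theorem summable_norm_of_sum_le {φ : ι → E →L[ℂ] ℂ}
    (hφ : ∀ (J : Finset ι) (f : E), ∑ i ∈ J, ‖φ i f‖ ≤ ‖f‖) (f : E) :
    Summable fun i => ‖φ i f‖ :=
  summable_of_sum_le (fun _ => norm_nonneg _) fun J => hφ J f

variable [CompleteSpace E]

theorem summable_smul_of_sum_le {φ : ι → E →L[ℂ] ℂ}
    (hφ : ∀ (J : Finset ι) (f : E), ∑ i ∈ J, ‖φ i f‖ ≤ ‖f‖) {v : ι → E} (hv : ∀ i, ‖v i‖ ≤ 1)
    (f : E) : Summable fun i => φ i f • v i := by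
  refine Summable.of_norm_bounded (summable_norm_of_sum_le hφ f) fun i => ?_
  rw [norm_smul]
  exact mul_le_of_le_one_right (norm_nonneg _) (hv i)

/-- The operator `f ↦ ∑ i, φ i f • v i` for an absolutely summing sequence of functionals `φ` and
a bounded family of vectors `v`. -/
def sumOperator (φ : ι → E →L[ℂ] ℂ)
    (hφ : ∀ (J : Finset ι) (f : E), ∑ i ∈ J, ‖φ i f‖ ≤ ‖f‖) (v : ι → E) (hv : ∀ i, ‖v i‖ ≤ 1) :
    E →L[ℂ] E :=
  LinearMap.mkContinuous
    { toFun := fun f => ∑' i, φ i f • v i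
      map_add' := fun f g => by
        simp only [map_add, add_smul]
        exact (summable_smul_of_sum_le hφ hv f).tsum_add (summable_smul_of_sum_le hφ hv g)
      map_smul' := fun c f => by
        simp only [map_smul, smul_eq_mul, mul_smul, RingHom.id_apply]
        exact (summable_smul_of_sum_le hφ hv f).tsum_const_smul c } 1 fun f => by
    rw [one_mul]
    refine tsum_of_norm_bounded (summable_norm_of_sum_le hφ f).hasSum (fun i => ?_) |>.trans ?_
    · rw [norm_smul]
      exact mul_le_of_le_one_right (norm_nonneg _) (hv i)
    · exact (summable_norm_of_sum_le hφ f).tsum_le_of_sum_le fun J => hφ J f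

theorem sumOperator_apply {φ : ι → E →L[ℂ] ℂ}
    (hφ : ∀ (J : Finset ι) (f : E), ∑ i ∈ J, ‖φ i f‖ ≤ ‖f‖) {v : ι → E} (hv : ∀ i, ‖v i‖ ≤ 1)
    (f : E) : sumOperator φ hφ v hv f = ∑' i, φ i f • v i := rfl

/-- A permutation of a biorthogonal system is implemented by a bounded operator. -/
theorem exists_operator_of_perm [DecidableEq ι] (φ : ι → E →L[ℂ] ℂ)
    (hφ : ∀ (J : Finset ι) (f : E), ∑ i ∈ J, ‖φ i f‖ ≤ ‖f‖) (v : ι → E) (hv : ∀ i, ‖v i‖ ≤ 1)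
    (hφv : ∀ i j, φ i (v j) = if i = j then 1 else 0) (σ : Equiv.Perm ι) :
    ∃ V : E →L[ℂ] E, (∀ i, V (v i) = v (σ i)) ∧ ∀ i f, φ (σ i) (V f) = φ i f := by
  refine ⟨sumOperator φ hφ (fun i => v (σ i)) fun i => hv _, fun i => ?_, fun i f => ?_⟩
  · rw [sumOperator_apply, tsum_eq_single i fun j hj => by simp [hφv, hj]]
    simp [hφv]
  · rw [sumOperator_apply, (φ (σ i)).map_tsum (summable_smul_of_sum_le hφ (fun i => hv _) f),
      tsum_eq_single i fun j hj => by simp [hφv, Ne.symm hj]]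
    simp [hφv]

end Shift

section Abstract

variable {E : Type*} [NormedAddCommGroup E] [NormedSpace ℂ E]

/-- The functional `T ↦ φ (T e)` on operators. -/
def matrixCoeff (φ : E →L[ℂ] ℂ) (e : E) : (E →L[ℂ] E) →ₗ[ℂ] ℂ where
  toFun T := φ (T e)
  map_add' S T := by simp
  map_smul' c T := by simp

@[simp]
theorem matrixCoeff_apply (φ : E →L[ℂ] ℂ) (e : E) (T : E →L[ℂ] E) :
    matrixCoeff φ e T = φ (T e) := rfl

/-- Every finite set of vectors is almost fixed by a finite rank contraction that factors through
a finite-dimensional `ℓ₁`. -/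
def HasL1Approximation (E : Type*) [NormedAddCommGroup E] [NormedSpace ℂ E] : Prop :=
  ∀ (H : Finset E) (η : ℝ), 0 < η → ∃ (k : ℕ) (e : Fin k → E) (ψ : Fin k → E →L[ℂ] ℂ),
    (∀ m, ‖e m‖ ≤ 1) ∧ (∀ f, ∑ m, ‖ψ m f‖ ≤ ‖f‖) ∧ ∀ h ∈ H, ‖h - ∑ m, ψ m h • e m‖ ≤ η

theorem sum_norm_tensFunctional_matrixCoeff_le {n k : ℕ} (hn : 0 < n) {φ : Fin n → E →L[ℂ] ℂ}
    {v : Fin n → E} (hφ : ∀ f, ∑ i, ‖φ i f‖ ≤ ‖f‖) (hv : ∀ i, ‖v i‖ ≤ 1) {e : Fin k → E}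
    {ψ : Fin k → E →L[ℂ] ℂ} (he : ∀ m, ‖e m‖ ≤ 1) (hψ : ∀ f, ∑ m, ‖ψ m f‖ ≤ ‖f‖)
    (u : TensorProduct ℂ (E →L[ℂ] E) (E →L[ℂ] E)) :
    ∑ m, ∑ i, ∑ j, ‖tensFunctional (matrixCoeff (φ i) (e m)) (matrixCoeff (ψ m) (v j)) u‖ ≤
      n * projNorm u := by
  refine sum_norm_tensFunctional_le (fun m i => matrixCoeff (φ i) (e m))
    (fun m j => matrixCoeff (ψ m) (v j)) (by exact_mod_cast hn) (fun x y => ?_) u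
  simp only [matrixCoeff_apply, ← Finset.mul_sum, ← Finset.sum_mul]
  have hx (m) : ∑ i, ‖φ i (x (e m))‖ ≤ ‖x‖ :=
    (hφ _).trans ((x.le_opNorm _).trans (mul_le_of_le_one_right (norm_nonneg _) (he m)))
  have hy (j) : ∑ m, ‖ψ m (y (v j))‖ ≤ ‖y‖ :=
    (hψ _).trans ((y.le_opNorm _).trans (mul_le_of_le_one_right (norm_nonneg _) (hv j)))
  calc ∑ m, (∑ i, ‖φ i (x (e m))‖) * ∑ j, ‖ψ m (y (v j))‖
      ≤ ∑ m, ‖x‖ * ∑ j, ‖ψ m (y (v j))‖ := by gcongr with m; exact hx m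
    _ = ‖x‖ * ∑ j, ∑ m, ‖ψ m (y (v j))‖ := by rw [← Finset.mul_sum, Finset.sum_comm]
    _ ≤ ‖x‖ * ∑ _j : Fin n, ‖y‖ := by gcongr with j; exact hy j
    _ = n * (‖x‖ * ‖y‖) := by simp; ring

theorem one_sub_le_sum_projNorm (hE : HasL1Approximation E) {n r K : ℕ} (hn : 0 < n)
    (hK : 0 < K) (σ : Bool → Equiv.Perm (Fin n))
    (hσ : ∀ F : Finset (Fin n), F.card ≤ r * (1 + 2 * K) →
      ∑ b : Bool, (F.filter fun x => σ b x ∈ F).card ≤ F.card)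
    {φ : Fin n → E →L[ℂ] ℂ} {v : Fin n → E} (hφ : ∀ f, ∑ i, ‖φ i f‖ ≤ ‖f‖)
    (hv : ∀ i, ‖v i‖ ≤ 1) (hφv : ∀ i, φ i (v i) = 1) {V : Bool → E →L[ℂ] E}
    (hV : ∀ b i, V b (v i) = v (σ b i)) (hφV : ∀ b i f, φ (σ b i) (V b f) = φ i f)
    {u : TensorProduct ℂ (E →L[ℂ] E) (E →L[ℂ] E)} (a b : Fin r → E →L[ℂ] E)
    (hu : u = ∑ k, a k ⊗ₜ[ℂ] b k) {δ : ℝ} (hδ : 0 < δ) :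
    1 - ‖tensMul u - 1‖ - δ ≤
      ∑ c, projNorm (diagL (V c) u - diagR (V c) u) + (r + 1) / K * projNorm u := by
  classical
  have hn0 : (0 : ℝ) < n := by exact_mod_cast hn
  have hφ1 (i) (f : E) : ‖φ i f‖ ≤ ‖f‖ :=
    (Finset.single_le_sum (f := fun i => ‖φ i f‖) (fun _ _ => norm_nonneg _)
      (Finset.mem_univ i)).trans (hφ f)
  set M : ℝ := 1 + ∑ k, ‖a k‖ with hM
  have hM0 : 0 < M := by positivity
  obtain ⟨q, e, ψ, he, hψ, happ⟩ := hE
    (Finset.univ.image fun p : Fin r × Fin n => b p.1 (v p.2)) (δ / M) (by positivity)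
  set T : Fin q → Fin n → Fin n → ℂ := fun m i j =>
    tensFunctional (matrixCoeff (φ i) (e m)) (matrixCoeff (ψ m) (v j)) u with hT
  have hTab (m i j) : T m i j = ∑ k, φ i (a k (e m)) * ψ m (b k (v j)) := by
    simp [hT, hu]
  have hdiag (i) : 1 - ‖tensMul u - 1‖ - δ ≤ ∑ m, ‖T m i i‖ := by
    have h1 : ∑ m, T m i i = φ i (tensMul u (v i)) -
        ∑ k, φ i (a k (b k (v i) - ∑ m, ψ m (b k (v i)) • e m)) := by
      have : tensMul u (v i) = ∑ k, a k (b k (v i)) := by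
        simp [hu, tensMul]
      rw [this]
      simp only [hTab, map_sub, map_sum, map_smul, smul_eq_mul, Finset.sum_sub_distrib,
        sub_sub_cancel]
      rw [Finset.sum_comm]
      simp only [mul_comm]
    have h2 : ‖∑ k, φ i (a k (b k (v i) - ∑ m, ψ m (b k (v i)) • e m))‖ ≤ δ := by
      calc _ ≤ ∑ k, ‖a k‖ * (δ / M) := by
            refine norm_sum_le_of_le _ fun k _ => (hφ1 i _).trans ((a k).le_opNorm _ |>.trans ?_)
            gcongr
            exact happ _ (Finset.mem_image_of_mem _ (Finset.mem_univ (k, i)))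
        _ ≤ M * (δ / M) := by
            rw [← Finset.sum_mul]; gcongr; linarith
        _ = δ := by field_simp
    have h3 : ‖φ i (tensMul u (v i)) - 1‖ ≤ ‖tensMul u - 1‖ := by
      have : φ i (tensMul u (v i)) - 1 = φ i ((tensMul u - 1) (v i)) := by simp [hφv]
      rw [this]
      exact (hφ1 i _).trans (((tensMul u - 1).le_opNorm _).trans
        (mul_le_of_le_one_right (norm_nonneg _) (hv i)))
    have h4 : ‖(1 : ℂ)‖ ≤ ‖∑ m, T m i i‖ + ‖φ i (tensMul u (v i)) - 1‖ +
        ‖∑ k, φ i (a k (b k (v i) - ∑ m, ψ m (b k (v i)) • e m))‖ := by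
      rw [h1]
      refine le_trans (le_of_eq ?_) ((norm_add_le _ _).trans
        (add_le_add ((norm_sub_le _ _)) le_rfl))
      congr 1; ring
    have h5 := norm_sum_le Finset.univ fun m => T m i i
    rw [norm_one] at h4
    linarith
  have hcomm (c : Bool) : ∑ m, ∑ i, ‖T m i i - T m (σ c i) (σ c i)‖ ≤
      n * projNorm (diagL (V c) u - diagR (V c) u) := by
    refine le_trans ?_ (sum_norm_tensFunctional_matrixCoeff_le hn (φ := fun i => φ (σ c i))
      (fun f => ?_) hv he hψ _)
    · gcongr with m _ i _
      refine le_trans (le_of_eq ?_) (Finset.single_le_sum (fun _ _ => norm_nonneg _)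
        (Finset.mem_univ i))
      rw [map_sub, tensFunctional_diagL (α' := matrixCoeff (φ i) (e m)) _ (fun x => by simp [hφV]),
        tensFunctional_diagR (β' := matrixCoeff (ψ m) (v (σ c i))) _ (fun x => by simp [hV])]
    · exact (Equiv.sum_comp (σ c) fun i => ‖φ i f‖).trans_le (hφ f)
  have hall := sum_norm_tensFunctional_matrixCoeff_le hn hφ hv he hψ u
  have hmain : n * (1 - ‖tensMul u - 1‖ - δ) ≤
      n * (∑ c, projNorm (diagL (V c) u - diagR (V c) u) + (r + 1) / K * projNorm u) := by
    calc n * (1 - ‖tensMul u - 1‖ - δ)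
        ≤ ∑ i, ∑ m, ‖T m i i‖ := by
          have := Finset.sum_le_sum fun i (_ : i ∈ Finset.univ) => hdiag i
          rwa [Finset.sum_const, Finset.card_univ, Fintype.card_fin, nsmul_eq_mul] at this
      _ = ∑ m, ∑ i, ‖T m i i‖ := Finset.sum_comm
      _ ≤ ∑ m, (∑ c, ∑ i, ‖T m i i - T m (σ c i) (σ c i)‖ +
            (r + 1) / K * ∑ i, ∑ j, ‖T m i j‖) := by
          gcongr with m
          simpa only [hTab] using sum_diag_le hK σ hσ (fun i k => φ i (a k (e m)))
            fun k j => ψ m (b k (v j))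
      _ = ∑ c, ∑ m, ∑ i, ‖T m i i - T m (σ c i) (σ c i)‖ +
            (r + 1) / K * ∑ m, ∑ i, ∑ j, ‖T m i j‖ := by
          rw [Finset.sum_add_distrib, Finset.sum_comm, Finset.mul_sum]
      _ ≤ ∑ c, n * projNorm (diagL (V c) u - diagR (V c) u) +
            (r + 1) / K * (n * projNorm u) := by
          gcongr with c
          exact hcomm c
      _ = _ := by rw [← Finset.mul_sum]; ring
  exact le_of_mul_le_mul_left hmain hn0

/-- A Banach space with the `ℓ₁` approximation property that contains `ℓ₁` complementably, in the
form of a biorthogonal system, has a nonamenable algebra of operators. -/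
theorem not_isAmenable_of_biorthogonal [CompleteSpace E] (hE : HasL1Approximation E)
    (h : ∀ (n : ℕ → ℕ), ∃ (φ : (Σ R, Fin (n R)) → E →L[ℂ] ℂ) (v : (Σ R, Fin (n R)) → E),
      (∀ (J : Finset _) f, ∑ i ∈ J, ‖φ i f‖ ≤ ‖f‖) ∧ (∀ i, ‖v i‖ ≤ 1) ∧
      ∀ i j, φ i (v j) = if i = j then 1 else 0) :
    ¬ IsAmenable (E →L[ℂ] E) := by
  classical
  rintro ⟨C, hC⟩
  choose n σ hn hσ using exists_perm_small_sets_sparse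
  obtain ⟨φ, v, hφ, hv, hφv⟩ := h n
  choose V hV hφV using fun b : Bool => exists_operator_of_perm φ hφ v hv hφv
    (Equiv.sigmaCongrRight fun R => σ R b)
  obtain ⟨u, huC, hu⟩ := hC {1, V true, V false} (1 / 10) (by norm_num)
  obtain ⟨r, a, b, hab⟩ := exists_eq_sum_fin_tmul u
  obtain ⟨K, hK⟩ := exists_nat_gt (4 * ((r + 1) * |C|))
  have hK0 : 0 < K := by
    have : (0 : ℝ) ≤ 4 * ((r + 1) * |C|) := by positivity
    exact_mod_cast this.trans_lt hK
  have hKr : (0 : ℝ) < K := by exact_mod_cast hK0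
  have key := one_sub_le_sum_projNorm hE (hn (r * (1 + 2 * K))) hK0 (σ (r * (1 + 2 * K)))
    (hσ (r * (1 + 2 * K))) (φ := fun i => φ ⟨_, i⟩) (v := fun i => v ⟨_, i⟩)
    (fun f => ?_) (fun i => hv _) (fun i => by simp [hφv]) (V := V)
    (fun b i => hV b ⟨_, i⟩) (fun b i f => hφV b ⟨_, i⟩ f) a b hab
    (show (0 : ℝ) < 1 / 10 by norm_num)
  · have h1 := (hu 1 (by simp)).2
    have h2 := (hu (V true) (by simp)).1
    have h3 := (hu (V false) (by simp)).1
    have h4 : (r + 1) / K * projNorm u ≤ 1 / 4 := by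
      calc (r + 1) / K * projNorm u ≤ (r + 1) / K * |C| := by
            gcongr; exact huC.trans (le_abs_self C)
        _ ≤ 1 / 4 := by rw [div_mul_eq_mul_div, div_le_iff₀ hKr]; linarith
    rw [one_mul] at h1
    rw [Fintype.sum_bool] at key
    linarith
  · have := hφ (Finset.univ.map (Function.Embedding.sigmaMk (β := fun R => Fin (n R))
      (r * (1 + 2 * K)))) f
    simpa using this

end Abstract

section L1

variable {α : Type*} [MeasurableSpace α] {μ : Measure α}

theorem coeFn_sum_Lp {κ : Type*} (J : Finset κ) (f : κ → Lp ℂ 1 μ) :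
    ⇑(∑ p ∈ J, f p) =ᵐ[μ] fun x => ∑ p ∈ J, f p x := by
  classical
  induction J using Finset.induction_on with
  | empty => exact Lp.coeFn_zero ℂ 1 μ
  | insert p J hp ih =>
    rw [Finset.sum_insert hp]
    filter_upwards [Lp.coeFn_add (f p) (∑ q ∈ J, f q), ih] with x h1 h2
    rw [h1, Pi.add_apply, h2, Finset.sum_insert hp]

/-- Integration over a set as a functional on `L₁`. -/
def setIntegralL1 (μ : Measure α) (s : Set α) : Lp ℂ 1 μ →L[ℂ] ℂ :=
  LinearMap.mkContinuous
    { toFun := fun f => ∫ x in s, f x ∂μ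
      map_add' := fun f g => by
        rw [← integral_add (L1.integrable_coeFn f).integrableOn
          (L1.integrable_coeFn g).integrableOn]
        exact integral_congr_ae (ae_restrict_of_ae (Lp.coeFn_add f g))
      map_smul' := fun c f => by
        rw [RingHom.id_apply, ← integral_smul]
        exact integral_congr_ae (ae_restrict_of_ae (Lp.coeFn_smul c f)) } 1 fun f => by
    rw [one_mul, L1.norm_eq_integral_norm]
    exact (norm_integral_le_integral_norm _).trans (setIntegral_le_integral
      (L1.integrable_coeFn f).norm (Eventually.of_forall fun _ => norm_nonneg _))

theorem setIntegralL1_apply (s : Set α) (f : Lp ℂ 1 μ) :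
    setIntegralL1 μ s f = ∫ x in s, f x ∂μ := rfl

theorem sum_norm_setIntegralL1_le {ι : Type*} {s : ι → Set α} (hs : ∀ i, MeasurableSet (s i))
    (hd : Pairwise (Function.onFun Disjoint s)) (J : Finset ι) (f : Lp ℂ 1 μ) :
    ∑ i ∈ J, ‖setIntegralL1 μ (s i) f‖ ≤ ‖f‖ := by
  have hf := (L1.integrable_coeFn f).norm
  calc _ ≤ ∑ i ∈ J, ∫ x in s i, ‖f x‖ ∂μ :=
        Finset.sum_le_sum fun i _ => norm_integral_le_integral_norm _
    _ = ∫ x in ⋃ i ∈ J, s i, ‖f x‖ ∂μ :=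
        (integral_biUnion_finset J (fun i _ => hs i) (hd.set_pairwise _)
          fun i _ => hf.integrableOn).symm
    _ ≤ ∫ x, ‖f x‖ ∂μ :=
        setIntegral_le_integral hf (Eventually.of_forall fun _ => norm_nonneg _)
    _ = ‖f‖ := (L1.norm_eq_integral_norm f).symm

variable [IsFiniteMeasure μ]

/-- The indicator of a set normalized in `L₁` (zero if the set is null). -/
def normIndicator (μ : Measure α) [IsFiniteMeasure μ] {s : Set α} (hs : MeasurableSet s) :
    Lp ℂ 1 μ :=
  indicatorConstLp 1 hs (measure_ne_top μ s) (((μ.real s)⁻¹ : ℝ) : ℂ)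

theorem norm_normIndicator_le {s : Set α} (hs : MeasurableSet s) : ‖normIndicator μ hs‖ ≤ 1 := by
  refine norm_indicatorConstLp_le.trans ?_
  simp only [ENNReal.toReal_one, div_one, Real.rpow_one, Complex.norm_real, norm_inv,
    Real.norm_of_nonneg measureReal_nonneg]
  exact inv_mul_le_one

theorem setIntegralL1_indicatorConstLp {s t : Set α} (hs : MeasurableSet s)
    (ht : MeasurableSet t) (c : ℂ) :
    setIntegralL1 μ s (indicatorConstLp 1 ht (measure_ne_top μ t) c) = μ.real (t ∩ s) * c := by
  rw [setIntegralL1_apply, setIntegral_indicatorConstLp hs, Complex.real_smul]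

theorem smul_normIndicator {s : Set α} (hs : MeasurableSet s) (c : ℂ) :
    (μ.real s * c) • normIndicator μ hs = indicatorConstLp 1 hs (measure_ne_top μ s) c := by
  by_cases h : μ.real s = 0
  · rw [h]
    simp only [Complex.ofReal_zero, zero_mul, zero_smul]
    refine (norm_le_zero_iff.1 (norm_indicatorConstLp_le.trans ?_)).symm
    simp [h]
  · have h' : (μ.real s : ℂ) ≠ 0 := by exact_mod_cast h
    rw [normIndicator, indicatorConstLp, indicatorConstLp, ← MemLp.toLp_const_smul]
    congr 1
    funext x
    by_cases hx : x ∈ s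
    · simp only [Pi.smul_apply, Set.indicator_of_mem hx, smul_eq_mul, Complex.ofReal_inv]
      field_simp
    · simp [hx]

theorem sum_setIntegralL1_smul_normIndicator {κ : Type*} [Fintype κ] {s : κ → Set α}
    (hs : ∀ i, MeasurableSet (s i)) (hd : Pairwise (Function.onFun Disjoint s)) (c : κ → ℂ) :
    ∑ p, setIntegralL1 μ (s p) (∑ q, indicatorConstLp 1 (hs q) (measure_ne_top μ _) (c q)) •
        normIndicator μ (hs p) =
      ∑ q, indicatorConstLp 1 (hs q) (measure_ne_top μ _) (c q) := by
  refine Finset.sum_congr rfl fun p _ => ?_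
  rw [map_sum, Finset.sum_eq_single p, setIntegralL1_indicatorConstLp (hs p), Set.inter_self,
    smul_normIndicator]
  · intro q _ hq
    rw [setIntegralL1_indicatorConstLp (hs p), (hd hq).inter_eq]
    simp
  · simp

theorem hasL1Approximation_L1 (μ : Measure α) [IsFiniteMeasure μ] :
    HasL1Approximation (Lp ℂ 1 μ) := by
  classical
  intro H η hη
  have hg (h : H) : ∃ g : SimpleFunc α ℂ,
      eLpNorm (⇑(h : Lp ℂ 1 μ) - ⇑g) 1 μ < ENNReal.ofReal (η / 2) ∧ MemLp g 1 μ :=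
    (Lp.memLp h.1).exists_simpleFunc_eLpNorm_sub_lt (by simp) (by simpa using hη)
  choose g hgη hg1 using hg
  let κ := {p : H → ℂ // p ∈ Fintype.piFinset fun h => (g h).range}
  let e := Fintype.equivFin κ
  let s : κ → Set α := fun p => {x | ∀ h, g h x = p.1 h}
  have hs (p) : MeasurableSet (s p) := by
    have : s p = ⋂ h, g h ⁻¹' {p.1 h} := by ext; simp [s]
    rw [this]
    exact MeasurableSet.iInter fun h => (g h).measurableSet_preimage _
  have hd : Pairwise (Function.onFun Disjoint s) := fun p q hpq =>
    Set.disjoint_left.2 fun x hp hq => hpq (Subtype.ext (funext fun h => (hp h).symm.trans (hq h)))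
  have hsum (f : Lp ℂ 1 μ) : ∑ p, ‖setIntegralL1 μ (s p) f‖ ≤ ‖f‖ :=
    sum_norm_setIntegralL1_le hs hd Finset.univ f
  refine ⟨Fintype.card κ, fun m => normIndicator μ (hs (e.symm m)),
    fun m => setIntegralL1 μ (s (e.symm m)), fun m => norm_normIndicator_le _, fun f => ?_,
    fun h hh => ?_⟩
  · exact (Equiv.sum_comp e.symm fun p => ‖setIntegralL1 μ (s p) f‖).trans_le (hsum f)
  rw [Equiv.sum_comp e.symm fun p => setIntegralL1 μ (s p) h • normIndicator μ (hs p)]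
  set G : Lp ℂ 1 μ := ∑ p : κ, indicatorConstLp 1 (hs p) (measure_ne_top μ _) (p.1 ⟨h, hh⟩)
  have hGg : G =ᵐ[μ] g ⟨h, hh⟩ := by
    refine (coeFn_sum_Lp Finset.univ _).trans ?_
    have hae : ∀ᵐ x ∂μ, ∀ p : κ, indicatorConstLp 1 (hs p) (measure_ne_top μ _) (p.1 ⟨h, hh⟩) x =
        (s p).indicator (fun _ => p.1 ⟨h, hh⟩) x := ae_all_iff.2 fun p => indicatorConstLp_coeFn
    filter_upwards [hae] with x hx
    let q : κ := ⟨fun h => g h x, by simp [Fintype.mem_piFinset]⟩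
    have hq : x ∈ s q := fun _ => rfl
    rw [Finset.sum_congr rfl fun p _ => hx p, Finset.sum_eq_single q]
    · rw [Set.indicator_of_mem hq]
    · intro p _ hpq
      exact Set.indicator_of_notMem (fun hp => Set.disjoint_left.1 (hd hpq) hp hq) _
    · simp
  have hGh : ‖h - G‖ ≤ η / 2 := by
    rw [Lp.norm_def, eLpNorm_congr_ae ((Lp.coeFn_sub h G).trans (EventuallyEq.rfl.sub hGg))]
    exact ENNReal.toReal_le_of_le_ofReal (by positivity) (hgη ⟨h, hh⟩).le
  have hP : ‖∑ p, setIntegralL1 μ (s p) (h - G) • normIndicator μ (hs p)‖ ≤ η / 2 := by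
    refine (norm_sum_le_of_le _ fun p _ => ?_).trans ((hsum (h - G)).trans hGh)
    rw [norm_smul]
    exact mul_le_of_le_one_right (norm_nonneg _) (norm_normIndicator_le _)
  have hsplit : h - ∑ p, setIntegralL1 μ (s p) h • normIndicator μ (hs p) =
      (h - G) - ∑ p, setIntegralL1 μ (s p) (h - G) • normIndicator μ (hs p) := by
    simp only [map_sub, sub_smul, Finset.sum_sub_distrib]
    rw [sum_setIntegralL1_smul_normIndicator hs hd fun p : κ => p.1 ⟨h, hh⟩]
    abel
  rw [hsplit]
  refine (norm_sub_le _ _).trans ?_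
  linarith

theorem exists_biorthogonal_L1 {ι : Type*} [DecidableEq ι] {s : ι → Set α}
    (hs : ∀ i, MeasurableSet (s i)) (hd : Pairwise (Function.onFun Disjoint s))
    (h0 : ∀ i, μ (s i) ≠ 0) :
    ∃ (φ : ι → Lp ℂ 1 μ →L[ℂ] ℂ) (v : ι → Lp ℂ 1 μ),
      (∀ (J : Finset ι) f, ∑ i ∈ J, ‖φ i f‖ ≤ ‖f‖) ∧ (∀ i, ‖v i‖ ≤ 1) ∧
      ∀ i j, φ i (v j) = if i = j then 1 else 0 := by
  refine ⟨fun i => setIntegralL1 μ (s i), fun i => normIndicator μ (hs i),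
    sum_norm_setIntegralL1_le hs hd, fun i => norm_normIndicator_le _, fun i j => ?_⟩
  simp only [normIndicator]
  rw [setIntegralL1_indicatorConstLp (hs i)]
  split_ifs with h
  · subst h
    have : (μ.real (s i) : ℂ) ≠ 0 := by
      exact_mod_cast (measureReal_ne_zero_iff (measure_ne_top μ _)).2 (h0 i)
    rw [Set.inter_self, Complex.ofReal_inv, mul_inv_cancel₀ this]
  · rw [(hd (Ne.symm h)).inter_eq]
    simp

end L1

instance isFiniteMeasure_μ01 : IsFiniteMeasure μ01 := by
  unfold μ01; infer_instance

/-- The intervals `(1/(k+2), 1/(k+1)]`. -/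
def harmonicInterval (k : ℕ) : Set ℝ := Set.Ioc (1 / ((k : ℝ) + 2)) (1 / ((k : ℝ) + 1))

theorem pairwise_disjoint_harmonicInterval :
    Pairwise (Function.onFun Disjoint harmonicInterval) := by
  have key : ∀ k l : ℕ, k < l → Disjoint (harmonicInterval k) (harmonicInterval l) := by
    intro k l hkl
    refine Set.disjoint_left.2 fun x hk hl => absurd (hk.1.trans_le hl.2) (not_lt.2 ?_)
    refine one_div_le_one_div_of_le (by positivity) ?_
    have : (k : ℝ) + 1 ≤ l := by exact_mod_cast hkl
    linarith
  intro k l hkl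
  rcases hkl.lt_or_gt with h | h
  · exact key k l h
  · exact (key l k h).symm

theorem μ01_harmonicInterval_ne_zero (k : ℕ) : μ01 (harmonicInterval k) ≠ 0 := by
  have hsub : harmonicInterval k ⊆ Set.Icc 0 1 := fun x hx =>
    ⟨le_trans (by positivity) hx.1.le,
      hx.2.trans (by rw [div_le_one (by positivity)]; linarith [(Nat.cast_nonneg k : (0 : ℝ) ≤ k)])⟩
  rw [μ01, Measure.restrict_eq_self _ hsub, harmonicInterval,
    Real.volume_Ioc]
  have : 1 / ((k : ℝ) + 2) < 1 / ((k : ℝ) + 1) :=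
    one_div_lt_one_div_of_lt (by positivity) (by linarith)
  simpa using this

/-- The Banach algebra `B(L₁[0,1])` of all bounded linear operators on the complex Lebesgue
space `L₁[0,1]` is not amenable: it admits no bounded approximate diagonal. -/
theorem bounded_operators_on_L1_not_amenable :
    ¬ IsAmenable (L1C →L[ℂ] L1C) := by
  classical
  refine not_isAmenable_of_biorthogonal (hasL1Approximation_L1 μ01) fun n => ?_
  exact exists_biorthogonal_L1
    (s := fun i : Σ R, Fin (n R) => harmonicInterval (Encodable.encode i))
    (fun _ => measurableSet_Ioc)
    (pairwise_disjoint_harmonicInterval.comp_of_injective Encodable.encode_injective)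
    fun _ => μ01_harmonicInterval_ne_zero _
end
end

section
/- Let A be an amenable Banach algebra and let J be a closed two-sided ideal in A which has a bounded right approximate identity. Then J has a bounded left approximate identity. -/
open scoped TensorProduct ENNReal
open MeasureTheory Filter

noncomputable section

/-- A subset `J` of a normed algebra has a bounded right approximate identity: a norm-bounded
net `(e_α)` in `J` with `‖x - x * e_α‖ → 0` for every `x ∈ J` (equivalently, formulated via
the cofinal finite-set/ε criterion). -/
def HasBoundedRightApproxId {A : Type*} [NonUnitalNormedRing A] (J : Set A) : Prop :=
  ∃ C : ℝ, ∀ (F : Finset A), (∀ x ∈ F, x ∈ J) → ∀ ε : ℝ, 0 < ε →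
    ∃ e ∈ J, ‖e‖ ≤ C ∧ ∀ x ∈ F, ‖x - x * e‖ < ε

/-- A subset `J` of a normed algebra has a bounded left approximate identity: a norm-bounded
net `(e_α)` in `J` with `‖x - e_α * x‖ → 0` for every `x ∈ J`. -/
def HasBoundedLeftApproxId {A : Type*} [NonUnitalNormedRing A] (J : Set A) : Prop :=
  ∃ C : ℝ, ∀ (F : Finset A), (∀ x ∈ F, x ∈ J) → ∀ ε : ℝ, 0 < ε →
    ∃ e ∈ J, ‖e‖ ≤ C ∧ ∀ x ∈ F, ‖x - e * x‖ < ε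

/-- A subset `J` of a normed algebra has a (not necessarily bounded) left approximate
identity: a net `(v_β)` in `J` with `‖x - v_β * x‖ → 0` for every `x ∈ J`. -/
def HasLeftApproxId {A : Type*} [NonUnitalNormedRing A] (J : Set A) : Prop :=
  ∀ (F : Finset A), (∀ x ∈ F, x ∈ J) → ∀ ε : ℝ, 0 < ε →
    ∃ v ∈ J, ∀ x ∈ F, ‖x - v * x‖ < ε

section

variable {A : Type*} [NonUnitalNormedRing A] [NormedSpace ℂ A]

theorem exists_list_eq_sum_tmul (u : A ⊗[ℂ] A) :
    ∃ l : List (A × A), u = (l.map fun p => p.1 ⊗ₜ[ℂ] p.2).sum := by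
  induction u using TensorProduct.induction_on with
  | zero => exact ⟨[], by simp⟩
  | tmul a b => exact ⟨[(a, b)], by simp⟩
  | add u v hu hv =>
    obtain ⟨l, rfl⟩ := hu
    obtain ⟨m, rfl⟩ := hv
    exact ⟨l ++ m, by simp⟩

/-- A linear map on `A ⊗ A` which is bounded by `c` on elementary tensors is bounded by `c`
for the projective tensor norm. -/
theorem norm_le_mul_projNorm (g : A ⊗[ℂ] A →ₗ[ℂ] A) {c : ℝ} (hc : 0 ≤ c)
    (hg : ∀ a b : A, ‖g (a ⊗ₜ[ℂ] b)‖ ≤ c * (‖a‖ * ‖b‖)) (u : A ⊗[ℂ] A) :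
    ‖g u‖ ≤ c * projNorm u := by
  rw [projNorm, ← smul_eq_mul, ← Real.sInf_smul_of_nonneg hc]
  obtain ⟨l₀, hl₀⟩ := exists_list_eq_sum_tmul u
  refine le_csInf (Set.Nonempty.smul_set ⟨_, l₀, hl₀, rfl⟩) ?_
  rintro _ ⟨_, ⟨l, rfl, rfl⟩, rfl⟩
  clear hl₀ l₀
  induction l with
  | nil => simp
  | cons p l ih =>
    simp only [List.map_cons, List.sum_cons, map_add, smul_eq_mul, mul_add] at ih ⊢
    exact (norm_add_le _ _).trans (add_le_add (hg _ _) ih)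

variable [SMulCommClass ℂ A A] [IsScalarTower ℂ A A]

/-- The linear map `A ⊗ A → A`, `x ⊗ y ↦ x * f * y`. -/
def sandwich (f : A) : A ⊗[ℂ] A →ₗ[ℂ] A :=
  TensorProduct.lift (LinearMap.mul ℂ A ∘ₗ LinearMap.mulRight ℂ f)

@[simp]
theorem sandwich_tmul (f a b : A) : sandwich f (a ⊗ₜ[ℂ] b) = a * f * b := by
  simp [sandwich]

theorem norm_sandwich_le (f : A) (u : A ⊗[ℂ] A) : ‖sandwich f u‖ ≤ ‖f‖ * projNorm u := by
  refine norm_le_mul_projNorm _ (norm_nonneg f) (fun a b => ?_) u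
  calc ‖sandwich f (a ⊗ₜ[ℂ] b)‖ ≤ ‖a‖ * ‖f‖ * ‖b‖ := by
        rw [sandwich_tmul]
        exact (norm_mul_le _ _).trans (by gcongr; exact norm_mul_le _ _)
    _ = ‖f‖ * (‖a‖ * ‖b‖) := by ring

theorem sandwich_diagR (f x : A) (u : A ⊗[ℂ] A) :
    sandwich f (diagR x u) = sandwich f u * x := by
  induction u using TensorProduct.induction_on with
  | zero => simp [diagR]
  | tmul a b => simp [diagR, mul_assoc]
  | add u v hu hv => simp_all [diagR, add_mul]

theorem sandwich_mem {J : Submodule ℂ A} (hJr : ∀ a ∈ J, ∀ b : A, a * b ∈ J)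
    (hJl : ∀ a ∈ J, ∀ b : A, b * a ∈ J) {f : A} (hf : f ∈ J) (u : A ⊗[ℂ] A) :
    sandwich f u ∈ J := by
  induction u using TensorProduct.induction_on with
  | zero => simp
  | tmul a b => simpa using hJr _ (hJl f hf a) b
  | add u v hu hv => simpa using J.add_mem hu hv

/-- If `f` is a right identity up to `δ` on a suitable finite subset of the right ideal `J`,
then inserting `f` in the middle of `x · u` changes `x * π(u)` by at most a multiple of `δ`. -/
theorem exists_norm_mul_tensMul_sub_sandwich_le {J : Submodule ℂ A}
    (hJr : ∀ a ∈ J, ∀ b : A, a * b ∈ J) (F : Finset A) (hF : ∀ x ∈ F, x ∈ J) (u : A ⊗[ℂ] A) :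
    ∃ (T : Finset A) (M : ℝ), (∀ y ∈ T, y ∈ J) ∧ 0 ≤ M ∧
      ∀ (f : A) (δ : ℝ), (∀ y ∈ T, ‖y - y * f‖ ≤ δ) →
        ∀ x ∈ F, ‖x * tensMul u - sandwich f (diagL x u)‖ ≤ M * δ := by
  classical
  induction u using TensorProduct.induction_on with
  | zero => exact ⟨∅, 0, by simp, le_rfl, by simp [diagL]⟩
  | tmul a b =>
    refine ⟨F.image (· * a), ‖b‖, ?_, norm_nonneg b, fun f δ h x hx => ?_⟩
    · simpa using fun x hx => hJr x (hF x hx) a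
    · have hxa := h (x * a) (Finset.mem_image_of_mem _ hx)
      calc ‖x * tensMul (a ⊗ₜ[ℂ] b) - sandwich f (diagL x (a ⊗ₜ[ℂ] b))‖
          = ‖(x * a - x * a * f) * b‖ := by simp [tensMul, diagL, sub_mul, mul_assoc]
        _ ≤ ‖x * a - x * a * f‖ * ‖b‖ := norm_mul_le _ _
        _ ≤ ‖b‖ * δ := by rw [mul_comm]; gcongr
  | add u v hu hv =>
    obtain ⟨T, M, hT, hM, h⟩ := hu
    obtain ⟨T', M', hT', hM', h'⟩ := hv
    refine ⟨T ∪ T', M + M', fun y hy => (Finset.mem_union.1 hy).elim (hT y) (hT' y),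
      add_nonneg hM hM', fun f δ hf x hx => ?_⟩
    have hu := h f δ (fun y hy => hf y (Finset.mem_union_left _ hy)) x hx
    have hv := h' f δ (fun y hy => hf y (Finset.mem_union_right _ hy)) x hx
    have key : x * tensMul (u + v) - sandwich f (diagL x (u + v)) =
        (x * tensMul u - sandwich f (diagL x u)) +
          (x * tensMul v - sandwich f (diagL x v)) := by
      simp only [diagL, map_add, mul_add]
      abel
    rw [key, add_mul]
    exact (norm_add_le _ _).trans (add_le_add hu hv)

end

/-- If `A` is an amenable Banach algebra and `J` is a closed two-sided ideal of `A` with a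
bounded right approximate identity, then `J` has a bounded left approximate identity. -/
theorem closed_ideal_of_amenable_brai_implies_blai
    {A : Type*} [NonUnitalNormedRing A] [NormedSpace ℂ A]
    [SMulCommClass ℂ A A] [IsScalarTower ℂ A A] [CompleteSpace A]
    (hA : IsAmenable A)
    (J : Submodule ℂ A) (hJclosed : IsClosed (J : Set A))
    (hJmul_right : ∀ a ∈ J, ∀ b : A, a * b ∈ J)
    (hJmul_left : ∀ a ∈ J, ∀ b : A, b * a ∈ J)
    (hRAI : HasBoundedRightApproxId (J : Set A)) :
    HasBoundedLeftApproxId (J : Set A) := by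
  obtain ⟨C, hC⟩ := hA
  obtain ⟨K, hK⟩ := hRAI
  refine ⟨|K| * |C|, fun F hF ε hε => ?_⟩
  obtain ⟨u, huC, hu⟩ := hC F (ε / (3 * (|K| + 1))) (by positivity)
  obtain ⟨T, M, hT, hM, hTM⟩ := exists_norm_mul_tensMul_sub_sandwich_le hJmul_right F hF u
  obtain ⟨f, hfJ, hfK, hf⟩ := hK T hT (ε / (3 * (M + 1))) (by positivity)
  have hfK' : ‖f‖ ≤ |K| := hfK.trans (le_abs_self K)
  refine ⟨sandwich f u, sandwich_mem hJmul_right hJmul_left hfJ u, ?_, fun x hx => ?_⟩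
  · calc ‖sandwich f u‖ ≤ ‖f‖ * projNorm u := norm_sandwich_le f u
      _ ≤ ‖f‖ * |C| := by gcongr; exact huC.trans (le_abs_self C)
      _ ≤ |K| * |C| := by gcongr
  · obtain ⟨hdiag, hunit⟩ := hu x hx
    have h₁ : ‖x - x * tensMul u‖ < ε / 3 := by
      rw [norm_sub_rev]
      refine hunit.trans_le ?_
      gcongr
      linarith [abs_nonneg K]
    have h₂ : ‖x * tensMul u - sandwich f (diagL x u)‖ ≤ ε / 3 := by
      refine (hTM f _ (fun y hy => (hf y hy).le) x hx).trans ?_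
      rw [mul_div_assoc', div_le_div_iff₀ (by positivity) (by positivity)]
      nlinarith
    have h₃ : ‖sandwich f (diagL x u) - sandwich f u * x‖ ≤ ε / 3 := by
      rw [← sandwich_diagR, ← map_sub]
      calc ‖sandwich f (diagL x u - diagR x u)‖
          ≤ ‖f‖ * projNorm (diagL x u - diagR x u) := norm_sandwich_le f _
        _ ≤ ‖f‖ * (ε / (3 * (|K| + 1))) := by gcongr
        _ ≤ |K| * (ε / (3 * (|K| + 1))) := by gcongr
        _ ≤ ε / 3 := by
          rw [mul_div_assoc', div_le_div_iff₀ (by positivity) (by positivity)]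
          nlinarith [abs_nonneg K]
    calc ‖x - sandwich f u * x‖
        = ‖(x - x * tensMul u) + (x * tensMul u - sandwich f (diagL x u)) +
            (sandwich f (diagL x u) - sandwich f u * x)‖ := by congr 1; abel
      _ ≤ ‖x - x * tensMul u‖ + ‖x * tensMul u - sandwich f (diagL x u)‖ +
            ‖sandwich f (diagL x u) - sandwich f u * x‖ := norm_add₃_le
      _ < ε := by linarith
end
end

section
/- Let A be an amenable Banach algebra and let J be a closed two-sided ideal in A which has a bounded left approximate identity. Then J has a bounded right approximate identity. -/
open scoped TensorProduct ENNReal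
open MeasureTheory Filter

noncomputable section

section InsertMul

variable {A : Type*} [NonUnitalNormedRing A] [NormedSpace ℂ A]

/-- Every tensor is represented by a list whose cost is below any bound exceeding its projective
norm. -/
lemma exists_list_of_projNorm_lt {u : TensorProduct ℂ A A} {r : ℝ} (h : projNorm u < r) :
    ∃ l : List (A × A), u = (l.map fun p => p.1 ⊗ₜ[ℂ] p.2).sum ∧
      (l.map fun p => ‖p.1‖ * ‖p.2‖).sum < r := by
  have hne : { r : ℝ | ∃ l : List (A × A), u = (l.map fun p => p.1 ⊗ₜ[ℂ] p.2).sum ∧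
      r = (l.map fun p => ‖p.1‖ * ‖p.2‖).sum }.Nonempty := by
    suffices ∃ l : List (A × A), u = (l.map fun p => p.1 ⊗ₜ[ℂ] p.2).sum from
      let ⟨l, hl⟩ := this; ⟨_, l, hl, rfl⟩
    clear h
    induction u using TensorProduct.induction_on with
    | zero => exact ⟨[], by simp⟩
    | tmul x y => exact ⟨[(x, y)], by simp⟩
    | add u v hu hv =>
      obtain ⟨l, rfl⟩ := hu
      obtain ⟨m, rfl⟩ := hv
      exact ⟨l ++ m, by simp⟩
  obtain ⟨_, ⟨l, hl, rfl⟩, hlt⟩ := exists_lt_of_csInf_lt hne h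
  exact ⟨l, hl, hlt⟩

/-- A linear map on the tensor product that is bounded by `M` on elementary tensors is bounded
by `M` for the projective norm. -/
lemma norm_le_of_projNorm_lt {M : ℝ} (hM : 0 ≤ M) (φ : TensorProduct ℂ A A →ₗ[ℂ] A)
    (hφ : ∀ x y, ‖φ (x ⊗ₜ[ℂ] y)‖ ≤ M * (‖x‖ * ‖y‖)) {u : TensorProduct ℂ A A} {r : ℝ}
    (h : projNorm u < r) : ‖φ u‖ ≤ M * r := by
  obtain ⟨l, rfl, hlt⟩ := exists_list_of_projNorm_lt h
  refine le_trans ?_ (mul_le_mul_of_nonneg_left hlt.le hM)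
  clear h hlt
  induction l with
  | nil => simp
  | cons p l ih =>
    simp only [List.map_cons, List.sum_cons, map_add, mul_add]
    exact (norm_add_le _ _).trans (add_le_add (hφ _ _) ih)

variable [SMulCommClass ℂ A A] [IsScalarTower ℂ A A]

/-- The linear map `A ⊗ A → A`, `x ⊗ y ↦ x * (e * y)`. -/
def insertMul (e : A) : TensorProduct ℂ A A →ₗ[ℂ] A :=
  TensorProduct.lift ((LinearMap.mul ℂ A).compl₂ (LinearMap.mulLeft ℂ e))

@[simp]
lemma insertMul_tmul (e x y : A) : insertMul e (x ⊗ₜ[ℂ] y) = x * (e * y) := by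
  simp [insertMul]

@[simp]
lemma tensMul_tmul (x y : A) : tensMul (x ⊗ₜ[ℂ] y) = x * y := by
  simp [tensMul]

lemma insertMul_diagL (e a : A) (u : TensorProduct ℂ A A) :
    insertMul e (diagL a u) = a * insertMul e u := by
  unfold diagL
  induction u using TensorProduct.induction_on with
  | zero => simp
  | tmul x y => simp [mul_assoc]
  | add u v hu hv => simp only [map_add, hu, hv, mul_add]

lemma tensMul_diagL (a : A) (u : TensorProduct ℂ A A) :
    tensMul (diagL a u) = a * tensMul u := by
  unfold diagL
  induction u using TensorProduct.induction_on with
  | zero => simp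
  | tmul x y => simp [mul_assoc]
  | add u v hu hv => simp only [map_add, hu, hv, mul_add]

lemma insertMul_diagR (e a : A) (u : TensorProduct ℂ A A) :
    insertMul e (diagR a u) = insertMul e u * a := by
  unfold diagR
  induction u using TensorProduct.induction_on with
  | zero => simp
  | tmul x y => simp [mul_assoc]
  | add u v hu hv => simp only [map_add, hu, hv, add_mul]

lemma tensMul_diagR (a : A) (u : TensorProduct ℂ A A) :
    tensMul (diagR a u) = tensMul u * a := by
  unfold diagR
  induction u using TensorProduct.induction_on with
  | zero => simp
  | tmul x y => simp [mul_assoc]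
  | add u v hu hv => simp only [map_add, hu, hv, add_mul]

lemma norm_insertMul_tmul_le {e : A} {M : ℝ} (he : ‖e‖ ≤ M) (x y : A) :
    ‖insertMul e (x ⊗ₜ[ℂ] y)‖ ≤ M * (‖x‖ * ‖y‖) := by
  rw [insertMul_tmul]
  calc ‖x * (e * y)‖ ≤ ‖x‖ * (‖e‖ * ‖y‖) := norm_mul_le_of_le le_rfl (norm_mul_le _ _)
    _ ≤ ‖x‖ * (M * ‖y‖) := by gcongr
    _ = M * (‖x‖ * ‖y‖) := by ring

lemma insertMul_mem {J : Submodule ℂ A} (hJr : ∀ a ∈ J, ∀ b : A, a * b ∈ J)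
    (hJl : ∀ a ∈ J, ∀ b : A, b * a ∈ J) {e : A} (he : e ∈ J) (u : TensorProduct ℂ A A) :
    insertMul e u ∈ J := by
  induction u using TensorProduct.induction_on with
  | zero => simp
  | tmul x y => simpa using hJl _ (hJr _ he y) x
  | add u v hu hv => simpa using J.add_mem hu hv

/-- If `e` is almost a left identity on the products `y * a` occurring in `u · a`, then inserting
`e` hardly changes `π(u) * a`. -/
lemma norm_tensMul_mul_sub_insertMul_mul_le (l : List (A × A)) {a e : A} {δ : ℝ}
    (h : ∀ p ∈ l, ‖p.2 * a - e * (p.2 * a)‖ ≤ δ) :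
    ‖tensMul (l.map fun p => p.1 ⊗ₜ[ℂ] p.2).sum * a
      - insertMul e (l.map fun p => p.1 ⊗ₜ[ℂ] p.2).sum * a‖ ≤ (l.map fun p => ‖p.1‖).sum * δ := by
  induction l with
  | nil => simp
  | cons p l ih =>
    simp only [List.mem_cons, forall_eq_or_imp] at h
    simp only [List.map_cons, List.sum_cons, map_add, add_mul, tensMul_tmul, insertMul_tmul]
    rw [add_sub_add_comm]
    refine (norm_add_le _ _).trans (add_le_add ?_ (ih h.2))
    have : p.1 * p.2 * a - p.1 * (e * p.2) * a = p.1 * (p.2 * a - e * (p.2 * a)) := by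
      simp only [mul_sub, mul_assoc]
    rw [this]
    exact norm_mul_le_of_le le_rfl h.1

end InsertMul

/-- If `A` is an amenable Banach algebra and `J` is a closed two-sided ideal of `A` with a
bounded left approximate identity, then `J` has a bounded right approximate identity. -/
theorem closed_ideal_of_amenable_blai_implies_brai
    {A : Type*} [NonUnitalNormedRing A] [NormedSpace ℂ A]
    [SMulCommClass ℂ A A] [IsScalarTower ℂ A A] [CompleteSpace A]
    (hA : IsAmenable A)
    (J : Submodule ℂ A) (hJclosed : IsClosed (J : Set A))
    (hJmul_right : ∀ a ∈ J, ∀ b : A, a * b ∈ J)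
    (hJmul_left : ∀ a ∈ J, ∀ b : A, b * a ∈ J)
    (hLAI : HasBoundedLeftApproxId (J : Set A)) :
    HasBoundedRightApproxId (J : Set A) := by
  classical
  obtain ⟨C, hC⟩ := hA
  obtain ⟨K, hK⟩ := hLAI
  set M : ℝ := max K 1
  have hM1 : 1 ≤ M := le_max_right _ _
  have hM0 : 0 < M := by linarith
  refine ⟨M * (C + 1), fun F hF ε hε => ?_⟩
  obtain ⟨u, huC, hu⟩ := hC F (ε / (4 * M)) (by positivity)
  have huC' : projNorm u < C + 1 := by linarith
  obtain ⟨l, hl, -⟩ := exists_list_of_projNorm_lt huC'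
  set R : ℝ := (l.map fun p => ‖p.1‖).sum
  have hR : 0 ≤ R := List.sum_nonneg (by
    simp only [List.mem_map]
    rintro _ ⟨p, -, rfl⟩
    exact norm_nonneg _)
  obtain ⟨e, heJ, heK, he⟩ := hK ((l.toFinset ×ˢ F).image fun q => q.1.2 * q.2)
    (by
      simp only [Finset.mem_image, Finset.mem_product]
      rintro _ ⟨q, hq, rfl⟩
      exact hJmul_left _ (hF _ hq.2) _) (ε / (4 * (R + 1))) (by positivity)
  have heM : ‖e‖ ≤ M := heK.trans (le_max_left _ _)
  refine ⟨insertMul e u, insertMul_mem hJmul_right hJmul_left heJ u,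
    norm_le_of_projNorm_lt hM0.le _ (norm_insertMul_tmul_le heM) huC', fun a ha => ?_⟩
  obtain ⟨hcomm, hid⟩ := hu a ha
  have h₁ : ‖a - a * tensMul u‖ < ε / 4 := by
    rw [norm_sub_rev]
    exact hid.trans_le (div_le_div_of_nonneg_left hε.le (by norm_num) (by linarith))
  have h₂ : ‖a * tensMul u - tensMul u * a‖ ≤ ε / 4 := by
    have := norm_le_of_projNorm_lt zero_le_one tensMul
      (fun x y => by simpa using norm_mul_le x y) hcomm
    rw [map_sub, tensMul_diagL, tensMul_diagR, one_mul] at this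
    exact this.trans (div_le_div_of_nonneg_left hε.le (by norm_num) (by linarith))
  have h₃ : ‖tensMul u * a - insertMul e u * a‖ ≤ ε / 4 := by
    have := norm_tensMul_mul_sub_insertMul_mul_le l (a := a) (e := e) (δ := ε / (4 * (R + 1)))
      fun p hp => (he _ (Finset.mem_image.2 ⟨(p, a), by simp [hp, ha], rfl⟩)).le
    rw [← hl] at this
    refine this.trans ?_
    calc R * (ε / (4 * (R + 1))) ≤ (R + 1) * (ε / (4 * (R + 1))) := by gcongr; linarith
      _ = ε / 4 := by field_simp
  have h₄ : ‖a * insertMul e u - insertMul e u * a‖ ≤ ε / 4 := by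
    have := norm_le_of_projNorm_lt hM0.le _ (norm_insertMul_tmul_le heM) hcomm
    rw [map_sub, insertMul_diagL, insertMul_diagR] at this
    refine this.trans_eq ?_
    field_simp
  calc ‖a - a * insertMul e u‖
      = ‖(a - a * tensMul u) + (a * tensMul u - tensMul u * a)
          + (tensMul u * a - insertMul e u * a)
          - (a * insertMul e u - insertMul e u * a)‖ := by congr 1; abel
    _ ≤ ‖a - a * tensMul u‖ + ‖a * tensMul u - tensMul u * a‖
          + ‖tensMul u * a - insertMul e u * a‖
          + ‖a * insertMul e u - insertMul e u * a‖ :=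
        (norm_sub_le _ _).trans (by gcongr; exact norm_add₃_le)
    _ < ε := by linarith
end
end
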